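/- arXiv:2411.13858 — 2 statements merged into one kernel-verified Lean document; each statement's English description precedes it below -/
import Mathlib

section
/- Let β ∈ Σ and set 𝔤_{[β]} = ⨁_{t>0, tβ∈Σ} 𝔤_{tβ} and 𝔤_{[−β]} = ⨁_{t>0, −tβ∈Σ} 𝔤_{−tβ}. Let 𝔥 ⊆ 𝔤 be a Lie subalgebra such that 𝔤_{[−β]} ⊆ 𝔥 and such that Y ∈ 𝔥 for some nonzero Y ∈ 𝔤_{[β]}. Then 𝔤_{[β]} ⊆ 𝔥. -/
variable {𝔤 : Type*} [LieRing 𝔤] [LieAlgebra ℝ 𝔤]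

/-- The restricted root space `𝔤_β = {x ∈ 𝔤 | [a, x] = β(a) • x for all a ∈ 𝔞}` of a linear
functional `β` on a subalgebra `𝔞`.  (For `β = 0` this is the centralizer `𝔤₀` of `𝔞`.) -/
def restrictedRootSpace (𝔞 : LieSubalgebra ℝ 𝔤) (β : Module.Dual ℝ ↥𝔞) :
    Submodule ℝ 𝔤 where
  carrier := {x : 𝔤 | ∀ a : ↥𝔞, ⁅(a : 𝔤), x⁆ = β a • x}
  add_mem' := by
    intro x y hx hy a
    rw [lie_add, hx a, hy a, smul_add]
  zero_mem' := by
    intro a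
    rw [lie_zero, smul_zero]
  smul_mem' := by
    intro c x hx a
    rw [lie_smul, hx a]
    exact smul_comm c (β a) x

/-- The set of restricted roots of `𝔤` relative to `𝔞`: the nonzero functionals `β` on `𝔞`
with `𝔤_β ≠ {0}`. -/
def restrictedRoots (𝔞 : LieSubalgebra ℝ 𝔤) : Set (Module.Dual ℝ ↥𝔞) :=
  {β | β ≠ 0 ∧ restrictedRootSpace 𝔞 β ≠ ⊥}

/-- `𝔞` is a maximal abelian subalgebra of `𝔤` all of whose elements act on `𝔤` by
`ℝ`-diagonalizable operators. -/
def IsMaximalRDiagonalizable (𝔞 : LieSubalgebra ℝ 𝔤) : Prop :=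
  IsLieAbelian ↥𝔞 ∧
  (∀ a ∈ 𝔞, (⨆ μ : ℝ, Module.End.eigenspace (LieAlgebra.ad ℝ 𝔤 a) μ) = ⊤) ∧
  ∀ 𝔟 : LieSubalgebra ℝ 𝔤, IsLieAbelian ↥𝔟 →
    (∀ a ∈ 𝔟, (⨆ μ : ℝ, Module.End.eigenspace (LieAlgebra.ad ℝ 𝔤 a) μ) = ⊤) →
    𝔞 ≤ 𝔟 → 𝔟 = 𝔞

/-- `𝔤_{[β]} = ⨁_{t > 0, tβ ∈ Σ} 𝔤_{tβ}`, the sum of the restricted root spaces of the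
positive multiples of `β` that are roots. -/
noncomputable def coarseRootSpace (𝔞 : LieSubalgebra ℝ 𝔤) (β : Module.Dual ℝ ↥𝔞) : Submodule ℝ 𝔤 :=
  ⨆ t : ℝ, ⨆ _ : 0 < t ∧ t • β ∈ restrictedRoots 𝔞, restrictedRootSpace 𝔞 (t • β)

section Ring

variable {R : Type*} [Ring R]

theorem iterate_commutator_mul {A B C : R} (hC : A * B - B * A = C) (hAC : A * C = C * A)
    (m : ℕ) (X : R) :
    (fun Y => A * Y - Y * A)^[m + 1] (B * X) =
      B * (fun Y => A * Y - Y * A)^[m + 1] X + (m + 1) • (C * (fun Y => A * Y - Y * A)^[m] X) := by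
  have hAB : A * B = B * A + C := by rw [← hC]; abel
  induction m generalizing X with
  | zero =>
    simp only [zero_add, Function.iterate_one, Function.iterate_zero, id_eq, one_smul]
    rw [← mul_assoc, hAB]
    noncomm_ring
  | succ m ih =>
    rw [Function.iterate_succ_apply', ih]
    simp only [Function.iterate_succ_apply']
    set Z := (fun Y => A * Y - Y * A)^[m] X
    simp only [mul_add, add_mul, mul_smul_comm, smul_mul_assoc, ← mul_assoc, mul_sub, sub_mul,
      hAB, hAC, add_smul, smul_sub, one_smul]
    noncomm_ring

theorem iterate_commutator_pow {A B C : R} (hC : A * B - B * A = C) (hAC : A * C = C * A)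
    (n : ℕ) :
    (fun Y => A * Y - Y * A)^[n] (B ^ n) = n.factorial • C ^ n ∧
      (fun Y => A * Y - Y * A)^[n + 1] (B ^ n) = 0 := by
  induction n with
  | zero => simp
  | succ n ih =>
    have key : (fun Y => A * Y - Y * A)^[n + 1] (B ^ (n + 1)) =
        (n + 1).factorial • C ^ (n + 1) := by
      rw [pow_succ' B, iterate_commutator_mul hC hAC, ih.2, ih.1, mul_zero, zero_add,
        mul_smul_comm, smul_smul, ← pow_succ', Nat.factorial_succ]
    refine ⟨key, ?_⟩
    rw [Function.iterate_succ_apply', key]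
    have : A * C ^ (n + 1) = C ^ (n + 1) * A := (Commute.pow_right hAC (n + 1)).eq
    simp only [mul_smul_comm, smul_mul_assoc, this, sub_self]

theorem iterate_commutator_eq_zero {A : R} {N : ℕ} (hA : A ^ N = 0) (X : R) :
    (fun Y => A * Y - Y * A)^[2 * N] X = 0 := by
  have hl : (LinearMap.mulLeft ℤ A) ^ N = 0 := by
    rw [LinearMap.pow_mulLeft, hA, LinearMap.mulLeft_zero_eq_zero]
  have hr : (-LinearMap.mulRight ℤ A) ^ N = 0 := by
    rw [neg_pow, LinearMap.pow_mulRight, hA, LinearMap.mulRight_zero_eq_zero, mul_zero]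
  have h : (LinearMap.mulLeft ℤ A + -LinearMap.mulRight ℤ A) ^ (2 * N) = 0 :=
    (LinearMap.commute_mulLeft_right (R := ℤ) A A).neg_right
      |>.add_pow_eq_zero_of_add_le_succ_of_pow_eq_zero hl hr (by omega)
  have h' := LinearMap.congr_fun h X
  rw [Module.End.pow_apply, ← sub_eq_add_neg] at h'
  exact h'

/-- The Kleinecke–Shirokov theorem: a commutator `AB - BA` commuting with the nilpotent element
`A` is nilpotent. -/
theorem isNilpotent_commutator [Algebra ℝ R] {A B C : R}
    (hC : A * B - B * A = C) (hAC : A * C = C * A) (hA : IsNilpotent A) : IsNilpotent C := by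
  obtain ⟨N, hN⟩ := hA
  refine ⟨2 * N, ?_⟩
  have h := (iterate_commutator_pow hC hAC (2 * N)).1
  rw [iterate_commutator_eq_zero hN] at h
  have h' : ((2 * N).factorial : ℝ) • C ^ (2 * N) = 0 := by
    rw [Nat.cast_smul_eq_nsmul]; exact h.symm
  exact (smul_eq_zero.mp h').resolve_left (by exact_mod_cast (Nat.factorial_ne_zero _))

theorem pow_succ_commutator {E Z H : R} (hH : E * Z - Z * E = H) (hE : H * E - E * H = 2 • E)
    (k : ℕ) : E ^ (k + 1) * Z - Z * E ^ (k + 1) = (k + 1) • ((H - (k : R)) * E ^ k) := by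
  induction k with
  | zero => simp [hH]
  | succ k ih =>
    have h1 : E ^ (k + 1 + 1) * Z - Z * E ^ (k + 1 + 1) =
        E * (E ^ (k + 1) * Z - Z * E ^ (k + 1)) + (E * Z - Z * E) * E ^ (k + 1) := by
      rw [pow_succ' E (k + 1)]; noncomm_ring
    have h2 : E * H = H * E - 2 • E := by rw [← hE]; abel
    have h3 : E * ((H - (k : R)) * E ^ k) = (H - ((k + 2 : ℕ) : R)) * E ^ (k + 1) := by
      rw [← mul_assoc, mul_sub, h2, (Nat.cast_commute k E).symm.eq, pow_succ' E k, ← mul_assoc]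
      congr 1
      push_cast
      noncomm_ring
    rw [h1, ih, hH, mul_smul_comm, h3]
    push_cast
    simp only [sub_mul, add_mul, nsmul_eq_mul]
    push_cast
    noncomm_ring

end Ring

section Linear

open Module.End

variable {V : Type*} [AddCommGroup V] [Module ℝ V]

theorem sub_apply_eq_of_pow_succ_apply_eq_zero {E Z H : Module.End ℝ V}
    (hH : E * Z - Z * E = H) (hE : H * E - E * H = 2 • E) {k : ℕ} {v : V}
    (hv : (E ^ (k + 1)) v = 0) :
    ∃ v', (H - (k : ℝ) • (1 : Module.End ℝ V)) ((E ^ k) v) = (E ^ (k + 1)) v' ∧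
      (E ^ (k + 2)) v' = 0 := by
  have hk : ((k : ℝ) + 1) ≠ 0 := by positivity
  have h1 := LinearMap.congr_fun (pow_succ_commutator hH hE k) v
  have h2 := LinearMap.congr_fun (pow_succ_commutator hH hE (k + 1)) v
  have hv2 : (E ^ (k + 1 + 1)) v = 0 := by
    rw [pow_succ' E, Module.End.mul_apply, hv, map_zero]
  simp only [LinearMap.sub_apply, Module.End.mul_apply, hv, hv2, map_zero, sub_zero, smul_zero,
    LinearMap.smul_apply] at h1 h2
  refine ⟨((k : ℝ) + 1)⁻¹ • Z v, ?_, ?_⟩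
  · rw [map_smul, h1, ← Nat.cast_smul_eq_nsmul ℝ, smul_smul]
    push_cast
    rw [inv_mul_cancel₀ hk, one_smul]
    simp [Nat.cast_smul_eq_nsmul]
  · rw [map_smul, h2, smul_zero]

/-- A highest weight vector in the image of `E ^ k` has integral weight at least `k`. -/
theorem exists_nat_eq_of_mem_maxGenEigenspace {E Z H : Module.End ℝ V}
    (hH : E * Z - Z * E = H) (hE : H * E - E * H = 2 • E) (hnil : IsNilpotent E) {k : ℕ} {v : V}
    (hv : (E ^ (k + 1)) v = 0) (hv0 : (E ^ k) v ≠ 0) {c : ℝ}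
    (hc : (E ^ k) v ∈ H.maxGenEigenspace c) : ∃ i : ℕ, k ≤ i ∧ c = i := by
  obtain ⟨N, hN⟩ := hnil
  obtain ⟨m, hm⟩ : ∃ m, N ≤ k + m := ⟨N, by omega⟩
  induction m generalizing k v with
  | zero =>
    rw [pow_eq_zero_of_le (by omega : N ≤ k) hN] at hv0
    exact absurd rfl hv0
  | succ m ih =>
    obtain ⟨v', hv', hv'0⟩ := sub_apply_eq_of_pow_succ_apply_eq_zero hH hE hv
    by_cases h0 : (E ^ (k + 1)) v' = 0
    · refine ⟨k, le_rfl, ?_⟩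
      by_contra hne
      rw [h0] at hv'
      have hk : (E ^ k) v ∈ H.maxGenEigenspace (k : ℝ) :=
        (mem_maxGenEigenspace _ _ _).mpr ⟨1, by rwa [pow_one]⟩
      exact hv0 ((Submodule.disjoint_def.mp (disjoint_genEigenspace H hne ⊤ ⊤)) _ hc hk)
    · have hmem : (E ^ (k + 1)) v' ∈ H.maxGenEigenspace c := by
        rw [← hv']
        refine mapsTo_maxGenEigenspace_of_comm ?_ c hc
        exact (Commute.refl H).sub_right ((Commute.one_right H).smul_right _)
      obtain ⟨i, hi, rfl⟩ := ih hv'0 h0 hmem (by omega)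
      exact ⟨i, by omega, rfl⟩

theorem mem_iSup_maxGenEigenspace_of_sub_apply_mem (H : Module.End ℝ V) (c : ℝ) {x : V}
    (hx : (H - c • (1 : Module.End ℝ V)) x ∈ ⨆ μ, H.maxGenEigenspace μ) :
    x ∈ ⨆ μ, H.maxGenEigenspace μ := by
  have key : ∀ y ∈ ⨆ μ, H.maxGenEigenspace μ, ∃ z ∈ ⨆ μ, H.maxGenEigenspace μ,
      y - (H - c • (1 : Module.End ℝ V)) z ∈ H.maxGenEigenspace c := by
    intro y hy
    induction hy using Submodule.iSup_induction' with
    | mem μ y hy =>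
      by_cases hμ : μ = c
      · subst hμ
        exact ⟨0, Submodule.zero_mem _, by simpa using hy⟩
      · obtain ⟨n, hn⟩ := (mem_maxGenEigenspace _ _ _).mp hy
        have hcop : IsCoprime (Polynomial.X - Polynomial.C c)
            ((Polynomial.X - Polynomial.C μ) ^ n) :=
          (Polynomial.isCoprime_X_sub_C_of_isUnit_sub
            (sub_ne_zero.mpr (Ne.symm hμ)).isUnit).pow_right
        obtain ⟨a, b, hab⟩ := hcop
        have h := congrArg (fun p => Polynomial.aeval H p y) hab
        simp only [map_add, map_mul, map_pow, map_sub, Polynomial.aeval_X, Polynomial.aeval_C,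
          map_one, Algebra.algebraMap_eq_smul_one, LinearMap.add_apply, Module.End.mul_apply, hn,
          map_zero, add_zero, Module.End.one_apply] at h
        have hcomm : Commute H (Polynomial.aeval H a) := by
          simpa [Commute, SemiconjBy] using congrArg (Polynomial.aeval H) (mul_comm Polynomial.X a)
        have hcomm' : Commute (H - c • (1 : Module.End ℝ V)) (Polynomial.aeval H a) :=
          hcomm.sub_left ((Commute.one_left _).smul_left _)
        refine ⟨Polynomial.aeval H a y, Submodule.mem_iSup_of_mem μ
          (mapsTo_maxGenEigenspace_of_comm hcomm μ hy), ?_⟩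
        have h' := (LinearMap.congr_fun hcomm'.eq y).trans h
        rw [Module.End.mul_apply] at h'
        rw [h', sub_self]
        exact Submodule.zero_mem _
    | zero => exact ⟨0, Submodule.zero_mem _, by simp⟩
    | add y₁ y₂ _ _ h₁ h₂ =>
      obtain ⟨z₁, hz₁, h₁⟩ := h₁
      obtain ⟨z₂, hz₂, h₂⟩ := h₂
      refine ⟨z₁ + z₂, add_mem hz₁ hz₂, ?_⟩
      rw [map_add, add_sub_add_comm]
      exact add_mem h₁ h₂
  obtain ⟨z, hz, h⟩ := key _ hx
  rw [← map_sub] at h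
  obtain ⟨n, hn⟩ := (mem_maxGenEigenspace _ _ _).mp h
  have h' : x - z ∈ H.maxGenEigenspace c :=
    (mem_maxGenEigenspace _ _ _).mpr ⟨n + 1, by rwa [pow_succ, Module.End.mul_apply]⟩
  have := add_mem (Submodule.mem_iSup_of_mem c h') hz
  rwa [sub_add_cancel] at this

/-- The vectors that are killed by a product of factors `H - c`, `c` real. -/
inductive KilledBySplit (H : Module.End ℝ V) : V → Prop
  | zero : KilledBySplit H 0
  | step (c : ℝ) (x : V) : KilledBySplit H ((H - c • (1 : Module.End ℝ V)) x) → KilledBySplit H x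

theorem KilledBySplit.mem_iSup_maxGenEigenspace {H : Module.End ℝ V} {x : V}
    (hx : KilledBySplit H x) : x ∈ ⨆ μ, H.maxGenEigenspace μ := by
  induction hx with
  | zero => exact Submodule.zero_mem _
  | step c x _ ih => exact mem_iSup_maxGenEigenspace_of_sub_apply_mem H c ih

theorem killedBySplit_pow_apply {E Z H : Module.End ℝ V}
    (hH : E * Z - Z * E = H) (hE : H * E - E * H = 2 • E) (hnil : IsNilpotent E) {k : ℕ} {v : V}
    (hv : (E ^ (k + 1)) v = 0) : KilledBySplit H ((E ^ k) v) := by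
  obtain ⟨N, hN⟩ := hnil
  obtain ⟨m, hm⟩ : ∃ m, N ≤ k + m := ⟨N, by omega⟩
  induction m generalizing k v with
  | zero =>
    rw [pow_eq_zero_of_le (by omega : N ≤ k) hN]
    exact .zero
  | succ m ih =>
    obtain ⟨v', hv', hv'0⟩ := sub_apply_eq_of_pow_succ_apply_eq_zero hH hE hv
    refine .step k _ ?_
    rw [hv']
    exact ih hv'0 (by omega)

theorem killedBySplit_of_apply {E Z H : Module.End ℝ V}
    (hH : E * Z - Z * E = H) (hE : H * E - E * H = 2 • E) (hnil : IsNilpotent E) {v : V}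
    (hv : KilledBySplit H (E v)) : KilledBySplit H v := by
  generalize hy : E v = y at hv
  induction hv generalizing v with
  | zero => exact killedBySplit_pow_apply hH hE hnil (k := 0) (by simpa using hy)
  | step c x _ ih =>
    subst hy
    refine .step (c - 2) v (ih ?_)
    have h := LinearMap.congr_fun hE v
    simp only [LinearMap.sub_apply, Module.End.mul_apply, LinearMap.smul_apply,
      Module.End.one_apply, map_sub, map_smul, sub_smul] at h ⊢
    rw [sub_eq_iff_eq_add] at h
    rw [h]
    module

theorem iSup_maxGenEigenspace_eq_top_of_sl2 {E Z H : Module.End ℝ V}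
    (hH : E * Z - Z * E = H) (hE : H * E - E * H = 2 • E) (hnil : IsNilpotent E) :
    ⨆ μ, H.maxGenEigenspace μ = ⊤ := by
  refine eq_top_iff.mpr fun v _ => KilledBySplit.mem_iSup_maxGenEigenspace ?_
  obtain ⟨N, hN⟩ := id hnil
  have : ∀ n : ℕ, ∀ v, (E ^ n) v = 0 → KilledBySplit H v := by
    intro n
    induction n with
    | zero =>
      intro v hv
      rw [pow_zero, Module.End.one_apply] at hv
      exact hv ▸ .zero
    | succ n ih =>
      exact fun v hv => killedBySplit_of_apply hH hE hnil
        (ih _ (by rwa [pow_succ, Module.End.mul_apply] at hv))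
  exact this N v (by rw [hN, LinearMap.zero_apply])

theorem maxGenEigenspace_le_eigenspace {f : Module.End ℝ V} (hf : ⨆ μ, f.eigenspace μ = ⊤) (μ : ℝ) :
    f.maxGenEigenspace μ ≤ f.eigenspace μ := by
  intro x hx
  have htop : f.eigenspace μ ⊔ ⨆ ν ≠ μ, f.eigenspace ν = ⊤ := by
    rw [← hf]
    exact (iSup_split_single _ μ).symm
  obtain ⟨y, hy, z, hz, rfl⟩ := Submodule.mem_sup.mp (htop ▸ Submodule.mem_top : x ∈ _)
  have hle : ∀ ν, f.eigenspace ν ≤ f.maxGenEigenspace ν := fun ν =>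
    (f.genEigenspace ν).monotone le_top
  have hz' : z ∈ f.maxGenEigenspace μ := by simpa using sub_mem hx (hle μ hy)
  have : z = 0 := Submodule.disjoint_def.mp (f.independent_maxGenEigenspace μ) z hz'
    (iSup₂_mono (fun ν _ => hle ν) hz)
  rwa [this, add_zero]

theorem iSup_eigenspace_add_smul_eq_top [FiniteDimensional ℝ V] {f g : Module.End ℝ V}
    (hfg : Commute f g) (hf : ⨆ μ, f.eigenspace μ = ⊤) (hg : ⨆ μ, g.eigenspace μ = ⊤) (c : ℝ) :
    ⨆ μ, (f + c • g).eigenspace μ = ⊤ := by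
  have hgen : ∀ {f : Module.End ℝ V}, ⨆ μ, f.eigenspace μ = ⊤ → ⨆ μ, f.maxGenEigenspace μ = ⊤ :=
    fun {f} h => eq_top_iff.mpr (h ▸ iSup_mono fun ν => (f.genEigenspace ν).monotone le_top)
  have h := iSup_iInf_maxGenEigenspace_eq_top_of_iSup_maxGenEigenspace_eq_top_of_commute
    (fun b : Bool => cond b f g)
    (by rintro (_ | _) (_ | _) h <;> first | exact absurd rfl h | exact hfg | exact hfg.symm)
    (by rintro (_ | _); exacts [hgen hg, hgen hf])
  rw [eq_top_iff, ← h]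
  refine iSup_le fun χ x hx => ?_
  rw [Submodule.mem_iInf] at hx
  have h1 := mem_eigenspace_iff.mp (maxGenEigenspace_le_eigenspace hf _ (hx true))
  have h2 := mem_eigenspace_iff.mp (maxGenEigenspace_le_eigenspace hg _ (hx false))
  refine Submodule.mem_iSup_of_mem (χ true + c * χ false) (mem_eigenspace_iff.mpr ?_)
  rw [LinearMap.add_apply, LinearMap.smul_apply, h1, h2, add_smul, mul_smul]

theorem isNilpotent_of_commutator_eq [FiniteDimensional ℝ V] {D A : Module.End ℝ V}
    (h : D * A - A * D = A) : IsNilpotent A := by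
  by_contra hA
  have hpow : ∀ n : ℕ, D * A ^ n - A ^ n * D = (n : ℝ) • A ^ n := by
    intro n
    induction n with
    | zero => simp
    | succ n ih =>
      have : D * A ^ (n + 1) - A ^ (n + 1) * D =
          (D * A ^ n - A ^ n * D) * A + A ^ n * (D * A - A * D) := by
        rw [pow_succ]; noncomm_ring
      rw [this, ih, h, smul_mul_assoc, ← pow_succ]
      push_cast
      rw [add_smul, one_smul]
  let T : Module.End ℝ (Module.End ℝ V) := LinearMap.mulLeft ℝ D - LinearMap.mulRight ℝ D
  have hT : ∀ n : ℕ, T.HasEigenvalue (n : ℝ) := fun n =>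
    hasEigenvalue_of_hasEigenvector
      ⟨mem_eigenspace_iff.mpr (hpow n), fun h0 => hA ⟨n, h0⟩⟩
  have hfin : Set.Finite {μ : ℝ | T.HasEigenvalue μ} := finite_hasEigenvalue T
  exact Set.infinite_of_injective_forall_mem (Nat.cast_injective (R := ℝ)) hT hfin

theorem mem_maxGenEigenspace_of_sub_isNilpotent {f g : Module.End ℝ V} (hfg : Commute f g)
    (hn : IsNilpotent (f - g)) {c : ℝ} {x : V} (hx : g x = c • x) :
    x ∈ f.maxGenEigenspace c := by
  obtain ⟨k, hk⟩ := hn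
  have hcomm : Commute (f - g) (g - c • (1 : Module.End ℝ V)) :=
    (hfg.sub_left (Commute.refl g)).sub_right ((Commute.one_right _).smul_right _)
  have h : ∀ k : ℕ, ((f - c • (1 : Module.End ℝ V)) ^ k) x = ((f - g) ^ k) x := by
    intro k
    induction k with
    | zero => simp
    | succ k ih =>
      rw [pow_succ', Module.End.mul_apply, ih]
      have h1 : f - c • (1 : Module.End ℝ V) = (f - g) + (g - c • (1 : Module.End ℝ V)) := by abel
      rw [h1, LinearMap.add_apply, ← Module.End.mul_apply, ← Module.End.mul_apply,
        ← (hcomm.pow_left k).eq, ← pow_succ', Module.End.mul_apply (_ ^ k)]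
      simp [hx]
  exact (mem_maxGenEigenspace _ _ _).mpr ⟨k, by rw [h, hk, LinearMap.zero_apply]⟩

/-- An invariant subspace contains the components in generalized eigenspaces of its elements. -/
theorem mem_of_sum_mem_of_maxGenEigenspace {H : Module.End ℝ V} {W : Submodule ℝ V}
    (hW : ∀ x ∈ W, H x ∈ W) {ι : Type*} [DecidableEq ι] (s : Finset ι) (c : ι → ℝ)
    (y : ι → V) (hy : ∀ i ∈ s, y i ∈ H.maxGenEigenspace (c i)) (hsum : ∑ i ∈ s, y i ∈ W)
    {j : ι} (hj : j ∈ s) (hcj : ∀ i ∈ s, i ≠ j → c i ≠ c j) : y j ∈ W := by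
  have hpoly : ∀ p : Polynomial ℝ, ∀ x ∈ W, Polynomial.aeval H p x ∈ W := by
    intro p x hx
    induction p using Polynomial.induction_on' with
    | add p q hp hq => rw [map_add, LinearMap.add_apply]; exact add_mem hp hq
    | monomial n a =>
      rw [Polynomial.aeval_monomial, Module.End.mul_apply, Module.algebraMap_end_apply]
      refine W.smul_mem _ ?_
      induction n with
      | zero => simpa using hx
      | succ n ih => rw [pow_succ', Module.End.mul_apply]; exact hW _ ih
  have hn : ∀ i, ∃ n : ℕ, i ∈ s → ((H - c i • (1 : Module.End ℝ V)) ^ n) (y i) = 0 := by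
    intro i
    by_cases hi : i ∈ s
    · obtain ⟨n, hn⟩ := (mem_maxGenEigenspace _ _ _).mp (hy i hi)
      exact ⟨n, fun _ => hn⟩
    · exact ⟨0, fun h => absurd h hi⟩
  choose n hn using hn
  let q : Polynomial ℝ := ∏ i ∈ s.erase j, (Polynomial.X - Polynomial.C (c i)) ^ n i
  have hcop : IsCoprime q ((Polynomial.X - Polynomial.C (c j)) ^ n j) := by
    refine IsCoprime.prod_left fun i hi => ?_
    rw [Finset.mem_erase] at hi
    exact (Polynomial.isCoprime_X_sub_C_of_isUnit_sub
      (sub_ne_zero.mpr (hcj i hi.2 hi.1)).isUnit).pow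
  have haeval : ∀ i ∈ s, Polynomial.aeval H ((Polynomial.X - Polynomial.C (c i)) ^ n i) (y i) = 0 := by
    intro i hi
    simpa [Algebra.algebraMap_eq_smul_one] using hn i hi
  have hq : ∀ i ∈ s, i ≠ j → Polynomial.aeval H q (y i) = 0 := by
    intro i hi hij
    have hmem : i ∈ s.erase j := Finset.mem_erase.mpr ⟨hij, hi⟩
    rw [show q = _ from (Finset.prod_erase_mul _ _ hmem).symm, map_mul, Module.End.mul_apply,
      haeval i hi, map_zero]
  obtain ⟨a, b, hab⟩ := hcop
  have h := congrArg (fun p => Polynomial.aeval H p (y j)) hab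
  simp only [map_add, map_mul, LinearMap.add_apply, Module.End.mul_apply, haeval j hj, map_zero,
    add_zero, map_one, Module.End.one_apply] at h
  rw [← h]
  have hsum' := hpoly q _ hsum
  rw [map_sum, Finset.sum_eq_single_of_mem j hj hq] at hsum'
  exact hpoly a _ hsum'

end Linear

section RestrictedRoots

open Module.End LieAlgebra

variable {𝔞 : LieSubalgebra ℝ 𝔤} {β γ δ ε : Module.Dual ℝ 𝔞} {x y : 𝔤}

theorem mem_restrictedRootSpace :
    x ∈ restrictedRootSpace 𝔞 β ↔ ∀ a : 𝔞, ⁅(a : 𝔤), x⁆ = β a • x := Iff.rfl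

theorem lie_mem_restrictedRootSpace (hx : x ∈ restrictedRootSpace 𝔞 δ)
    (hy : y ∈ restrictedRootSpace 𝔞 ε) : ⁅x, y⁆ ∈ restrictedRootSpace 𝔞 (δ + ε) := by
  intro a
  rw [leibniz_lie, hx a, hy a, smul_lie, lie_smul, LinearMap.add_apply, add_smul]

theorem ad_pow_mem_restrictedRootSpace (hx : x ∈ restrictedRootSpace 𝔞 δ)
    (hy : y ∈ restrictedRootSpace 𝔞 ε) (k : ℕ) :
    ((ad ℝ 𝔤 x) ^ k) y ∈ restrictedRootSpace 𝔞 (k • δ + ε) := by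
  induction k with
  | zero => simpa using hy
  | succ k ih =>
    rw [pow_succ', Module.End.mul_apply, ad_apply, succ_nsmul', add_assoc]
    exact lie_mem_restrictedRootSpace hx ih

theorem killingForm_eq_zero_of_mem_restrictedRootSpace (hx : x ∈ restrictedRootSpace 𝔞 δ)
    (hy : y ∈ restrictedRootSpace 𝔞 ε) (h : δ + ε ≠ 0) : killingForm ℝ 𝔤 x y = 0 := by
  obtain ⟨a, ha⟩ : ∃ a, (δ + ε) a ≠ 0 := by
    by_contra! hc
    exact h (LinearMap.ext hc)
  have h1 := LieModule.traceForm_apply_lie_apply' ℝ 𝔤 𝔤 (a : 𝔤) x y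
  rw [hx a, hy a, map_smul, map_smul, LinearMap.smul_apply, smul_eq_mul, smul_eq_mul] at h1
  have h2 : (δ + ε) a * killingForm ℝ 𝔤 x y = 0 := by
    rw [LinearMap.add_apply, add_mul]
    exact (congrArg (· + _) h1).trans (neg_add_cancel _)
  exact (mul_eq_zero.mp h2).resolve_left ha

theorem ad_lie_eq_sub (x y : 𝔤) :
    ad ℝ 𝔤 ⁅x, y⁆ = ad ℝ 𝔤 x * ad ℝ 𝔤 y - ad ℝ 𝔤 y * ad ℝ 𝔤 x := by
  ext z
  simp

theorem commute_ad_of_lie_eq_zero (h : ⁅x, y⁆ = 0) : Commute (ad ℝ 𝔤 x) (ad ℝ 𝔤 y) := by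
  refine sub_eq_zero.mp ?_
  rw [← ad_lie_eq_sub, h, map_zero]

theorem lie_eq_zero_of_isLieAbelian (h : IsLieAbelian 𝔞) (a b : 𝔞) : ⁅(a : 𝔤), (b : 𝔤)⁆ = 0 := by
  rw [← LieSubalgebra.coe_bracket, trivial_lie_zero, ZeroMemClass.coe_zero]

theorem iInf_eigenspace_eq_restrictedRootSpace (β : Module.Dual ℝ 𝔞) :
    ⨅ a : 𝔞, (ad ℝ 𝔤 (a : 𝔤)).eigenspace (β a) = restrictedRootSpace 𝔞 β := by
  ext x
  simp [mem_restrictedRootSpace]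

theorem iInf_maxGenEigenspace_eq_restrictedRootSpace (h𝔞 : IsMaximalRDiagonalizable 𝔞)
    (β : Module.Dual ℝ 𝔞) :
    ⨅ a : 𝔞, (ad ℝ 𝔤 (a : 𝔤)).maxGenEigenspace (β a) = restrictedRootSpace 𝔞 β := by
  rw [← iInf_eigenspace_eq_restrictedRootSpace]
  exact iInf_congr fun a => le_antisymm
    (maxGenEigenspace_le_eigenspace (h𝔞.2.1 a a.2) _) ((genEigenspace _ _).monotone le_top)

theorem iSupIndep_restrictedRootSpace (h𝔞 : IsMaximalRDiagonalizable 𝔞) :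
    iSupIndep (restrictedRootSpace 𝔞) := by
  have h := independent_iInf_maxGenEigenspace_of_forall_mapsTo
    (fun a : 𝔞 => ad ℝ 𝔤 (a : 𝔤)) (fun a b φ => mapsTo_maxGenEigenspace_of_comm
      (commute_ad_of_lie_eq_zero (lie_eq_zero_of_isLieAbelian h𝔞.1 b a)) φ)
  have h' := h.comp (f := fun β : Module.Dual ℝ 𝔞 => (β : 𝔞 → ℝ)) DFunLike.coe_injective
  convert h' using 1
  funext β
  exact (iInf_maxGenEigenspace_eq_restrictedRootSpace h𝔞 β).symm

theorem iSup_restrictedRootSpace_eq_top [FiniteDimensional ℝ 𝔤]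
    (h𝔞 : IsMaximalRDiagonalizable 𝔞) : ⨆ β, restrictedRootSpace 𝔞 β = ⊤ := by
  have h := iSup_iInf_maxGenEigenspace_eq_top_of_iSup_maxGenEigenspace_eq_top_of_commute
    (fun a : 𝔞 => ad ℝ 𝔤 (a : 𝔤))
    (fun a b _ => commute_ad_of_lie_eq_zero (lie_eq_zero_of_isLieAbelian h𝔞.1 a b))
    (fun a => eq_top_iff.mpr ((h𝔞.2.1 a a.2).ge.trans
      (iSup_mono fun ν => (genEigenspace _ ν).monotone le_top)))
  rw [eq_top_iff, ← h]
  refine iSup_le fun χ x hx => ?_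
  by_cases hx0 : x = 0
  · exact hx0 ▸ Submodule.zero_mem _
  rw [Submodule.mem_iInf] at hx
  have hχ : ∀ a : 𝔞, ⁅(a : 𝔤), x⁆ = χ a • x := fun a =>
    mem_eigenspace_iff.mp (maxGenEigenspace_le_eigenspace (h𝔞.2.1 a a.2) _ (hx a))
  let β : Module.Dual ℝ 𝔞 :=
    { toFun := χ
      map_add' := fun a b => smul_left_injective ℝ hx0 (by
        simp only [add_smul, ← hχ]
        rw [← add_lie]; rfl)
      map_smul' := fun c a => smul_left_injective ℝ hx0 (by
        simp only [RingHom.id_apply, smul_eq_mul, mul_smul, ← hχ]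
        rw [← smul_lie]; rfl) }
  exact Submodule.mem_iSup_of_mem β hχ

theorem exists_add_of_mem_restrictedRootSpace [FiniteDimensional ℝ 𝔤]
    (h𝔞 : IsMaximalRDiagonalizable 𝔞) (δ : Module.Dual ℝ 𝔞) (x : 𝔤) :
    ∃ y ∈ restrictedRootSpace 𝔞 δ, ∃ z ∈ ⨆ ε ≠ δ, restrictedRootSpace 𝔞 ε, y + z = x := by
  have h : restrictedRootSpace 𝔞 δ ⊔ ⨆ ε ≠ δ, restrictedRootSpace 𝔞 ε = ⊤ := by
    rw [← iSup_restrictedRootSpace_eq_top h𝔞]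
    exact (iSup_split_single _ δ).symm
  exact Submodule.mem_sup.mp (h ▸ Submodule.mem_top)

theorem killingForm_eq_zero_of_mem_iSup {x z : 𝔤} (hx : x ∈ restrictedRootSpace 𝔞 δ)
    (hz : z ∈ ⨆ ε ≠ -δ, restrictedRootSpace 𝔞 ε) : killingForm ℝ 𝔤 x z = 0 := by
  have h : (⨆ ε ≠ -δ, restrictedRootSpace 𝔞 ε) ≤ LinearMap.ker (killingForm ℝ 𝔤 x) := by
    refine iSup₂_le fun ε hε z hz => ?_
    exact killingForm_eq_zero_of_mem_restrictedRootSpace hx hz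
      fun h => hε (eq_neg_of_add_eq_zero_right h)
  exact h hz

theorem restrictedRootSpace_smul_le_coarseRootSpace (hβ : β ≠ 0) {t : ℝ} (ht : 0 < t) :
    restrictedRootSpace 𝔞 (t • β) ≤ coarseRootSpace 𝔞 β := by
  intro x hx
  by_cases h : restrictedRootSpace 𝔞 (t • β) = ⊥
  · rw [h] at hx
    exact (Submodule.mem_bot ℝ).mp hx ▸ Submodule.zero_mem _
  · exact Submodule.mem_iSup_of_mem t
      (Submodule.mem_iSup_of_mem ⟨ht, smul_ne_zero ht.ne' hβ, h⟩ hx)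

theorem exists_finsupp_of_mem_coarseRootSpace (hx : x ∈ coarseRootSpace 𝔞 β) :
    ∃ f : ℝ →₀ 𝔤, (∀ t, f t ∈ restrictedRootSpace 𝔞 (t • β)) ∧ (∀ t ∈ f.support, 0 < t) ∧
      ∑ t ∈ f.support, f t = x := by
  obtain ⟨f, hf, hsum⟩ := (Submodule.mem_iSup_iff_exists_finsupp _ _).mp hx
  refine ⟨f, fun t => ?_, fun t ht => ?_, hsum⟩
  · exact (iSup_le fun _ => le_rfl : iSup _ ≤ restrictedRootSpace 𝔞 (t • β)) (hf t)
  by_contra h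
  have := hf t
  rw [iSup_neg (fun h' => h h'.1), Submodule.mem_bot] at this
  exact Finsupp.mem_support_iff.mp ht this

variable [FiniteDimensional ℝ 𝔤]

theorem isNilpotent_ad_of_mem_restrictedRootSpace (hγ : γ ≠ 0)
    (hx : x ∈ restrictedRootSpace 𝔞 γ) : IsNilpotent (ad ℝ 𝔤 x) := by
  obtain ⟨a, ha⟩ : ∃ a, γ a = 1 := LinearMap.surjective hγ 1
  refine isNilpotent_of_commutator_eq (D := ad ℝ 𝔤 (a : 𝔤)) ?_
  rw [← ad_lie_eq_sub, hx a, ha, one_smul]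

theorem killingForm_eq_zero_of_lie_lie_eq_zero (hγ : γ ≠ 0)
    (hx : x ∈ restrictedRootSpace 𝔞 γ) (hy : y ∈ restrictedRootSpace 𝔞 (-γ))
    (h : ⁅x, ⁅x, y⁆⁆ = 0) : killingForm ℝ 𝔤 x y = 0 := by
  obtain ⟨a, ha⟩ : ∃ a, γ a = 1 := LinearMap.surjective hγ 1
  have hxy : ⁅x, y⁆ ∈ restrictedRootSpace 𝔞 0 := by
    simpa using lie_mem_restrictedRootSpace hx hy
  have hnil : IsNilpotent (ad ℝ 𝔤 ⁅x, y⁆) := by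
    refine isNilpotent_commutator (A := ad ℝ 𝔤 x) (B := ad ℝ 𝔤 y) ?_
      (commute_ad_of_lie_eq_zero h) (isNilpotent_ad_of_mem_restrictedRootSpace hγ hx)
    rw [ad_lie_eq_sub]
  have hcomm : Commute (ad ℝ 𝔤 (a : 𝔤)) (ad ℝ 𝔤 ⁅x, y⁆) :=
    commute_ad_of_lie_eq_zero (by simpa using hxy a)
  have h1 := LieModule.traceForm_apply_lie_apply ℝ 𝔤 𝔤 (a : 𝔤) x y
  rw [hx a, ha, one_smul] at h1
  refine h1.trans ?_
  have h2 := LinearMap.isNilpotent_trace_of_isNilpotent (hcomm.isNilpotent_mul_left hnil)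
  exact isNilpotent_iff_eq_zero.mp h2

/-- An `ℝ`-diagonalizable element centralizing `𝔞` belongs to `𝔞`. -/
theorem mem_of_iSup_eigenspace_eq_top_of_lie_eq_zero (h𝔞 : IsMaximalRDiagonalizable 𝔞) {s : 𝔤}
    (hs : ⨆ μ, (ad ℝ 𝔤 s).eigenspace μ = ⊤) (hsa : ∀ a : 𝔞, ⁅(a : 𝔤), s⁆ = 0) : s ∈ 𝔞 := by
  have hlie : ∀ a b : 𝔞, ∀ c d : ℝ, ⁅(a : 𝔤) + c • s, (b : 𝔤) + d • s⁆ = 0 := by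
    intro a b c d
    have hsb : ⁅s, (b : 𝔤)⁆ = 0 := by rw [← lie_skew, hsa, neg_zero]
    simp [hsa, hsb, lie_eq_zero_of_isLieAbelian h𝔞.1]
  have hmem : ∀ x ∈ 𝔞.toSubmodule ⊔ ℝ ∙ s, ∃ a : 𝔞, ∃ c : ℝ, (a : 𝔤) + c • s = x := by
    intro x hx
    obtain ⟨a, ha, y, hy, rfl⟩ := Submodule.mem_sup.mp hx
    obtain ⟨c, rfl⟩ := Submodule.mem_span_singleton.mp hy
    exact ⟨⟨a, ha⟩, c, rfl⟩
  let 𝔟 : LieSubalgebra ℝ 𝔤 :=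
    { toSubmodule := 𝔞.toSubmodule ⊔ ℝ ∙ s
      lie_mem' := by
        intro x y hx hy
        obtain ⟨a, c, rfl⟩ := hmem x hx
        obtain ⟨b, d, rfl⟩ := hmem y hy
        rw [hlie]
        exact Submodule.zero_mem _ }
  have h𝔟 : 𝔟 = 𝔞 := by
    refine h𝔞.2.2 𝔟 ⟨?_⟩ ?_ fun x hx => Submodule.mem_sup_left hx
    · rintro ⟨x, hx⟩ ⟨y, hy⟩
      obtain ⟨a, c, rfl⟩ := hmem x hx
      obtain ⟨b, d, rfl⟩ := hmem y hy
      exact Subtype.ext (hlie a b c d)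
    · intro x hx
      obtain ⟨a, c, rfl⟩ := hmem x hx
      rw [map_add, map_smul]
      exact iSup_eigenspace_add_smul_eq_top (commute_ad_of_lie_eq_zero (hsa a))
        (h𝔞.2.1 a a.2) hs c
  rw [← h𝔟]
  exact Submodule.mem_sup_right (Submodule.mem_span_singleton_self s)

theorem exists_nat_two_mul_add_apply_eq {e z : 𝔤} {s : 𝔞} (hγ : γ ≠ 0)
    (he : e ∈ restrictedRootSpace 𝔞 γ) (hhe : ⁅⁅e, z⁆, e⁆ = (2 : ℕ) • e) (hγs : γ s = 2)
    (hs : ∀ δ, restrictedRootSpace 𝔞 δ ≤ (ad ℝ 𝔤 ⁅e, z⁆).maxGenEigenspace (δ s))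
    (hx : x ∈ restrictedRootSpace 𝔞 δ) (hx0 : x ≠ 0) :
    ∃ k i : ℕ, k ≤ i ∧ ((ad ℝ 𝔤 e) ^ k) x ≠ 0 ∧ 2 * k + δ s = i := by
  have hnil := isNilpotent_ad_of_mem_restrictedRootSpace hγ he
  have hex : ∃ k, ((ad ℝ 𝔤 e) ^ k) x = 0 := by
    obtain ⟨N, hN⟩ := hnil
    exact ⟨N, by rw [hN, LinearMap.zero_apply]⟩
  classical
  obtain ⟨k, hk⟩ : ∃ k, Nat.find hex = k + 1 :=
    Nat.exists_eq_succ_of_ne_zero fun h => hx0 (by simpa [h] using Nat.find_spec hex)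
  have hk0 : ((ad ℝ 𝔤 e) ^ k) x ≠ 0 := Nat.find_min hex (by omega)
  have hE : ad ℝ 𝔤 ⁅e, z⁆ * ad ℝ 𝔤 e - ad ℝ 𝔤 e * ad ℝ 𝔤 ⁅e, z⁆ = 2 • ad ℝ 𝔤 e := by
    rw [← ad_lie_eq_sub, hhe, map_nsmul]
  obtain ⟨i, hi, heq⟩ := exists_nat_eq_of_mem_maxGenEigenspace (ad_lie_eq_sub e z).symm hE hnil
    (hk ▸ Nat.find_spec hex) hk0 (hs _ (ad_pow_mem_restrictedRootSpace he hx k))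
  refine ⟨k, i, hi, hk0, ?_⟩
  rw [← heq, LinearMap.add_apply, LinearMap.smul_apply, hγs, nsmul_eq_mul, mul_comm]

variable [LieAlgebra.IsSemisimple ℝ 𝔤]

theorem eq_zero_of_forall_killingForm_eq_zero (h𝔞 : IsMaximalRDiagonalizable 𝔞)
    (hx : x ∈ restrictedRootSpace 𝔞 δ)
    (h : ∀ y ∈ restrictedRootSpace 𝔞 (-δ), killingForm ℝ 𝔤 x y = 0) : x = 0 := by
  have hker : x ∈ LinearMap.ker (killingForm ℝ 𝔤) := by
    refine LinearMap.ext fun y => ?_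
    obtain ⟨y, hy, z, hz, rfl⟩ := exists_add_of_mem_restrictedRootSpace h𝔞 (-δ) y
    rw [map_add, h y hy, killingForm_eq_zero_of_mem_iSup hx hz]
    simp
  simpa [IsKilling.ker_killingForm_eq_bot] using hker

theorem exists_lie_lie_eq (h𝔞 : IsMaximalRDiagonalizable 𝔞) (hγ : γ ≠ 0)
    {e : 𝔤} (he : e ∈ restrictedRootSpace 𝔞 γ) :
    ∃ z ∈ restrictedRootSpace 𝔞 (-γ), ⁅e, ⁅e, z⁆⁆ = e := by
  have hT : ∀ z ∈ ⨆ ε ≠ -γ, restrictedRootSpace 𝔞 ε,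
      ⁅e, ⁅e, z⁆⁆ ∈ ⨆ ε ≠ γ, restrictedRootSpace 𝔞 ε := by
    intro z hz
    have hle : (⨆ ε ≠ -γ, restrictedRootSpace 𝔞 ε) ≤
        (⨆ ε ≠ γ, restrictedRootSpace 𝔞 ε).comap (ad ℝ 𝔤 e ∘ₗ ad ℝ 𝔤 e) := by
      refine iSup₂_le fun ε hε z hz => ?_
      refine Submodule.mem_iSup_of_mem (γ + (γ + ε)) (Submodule.mem_iSup_of_mem ?_
        (lie_mem_restrictedRootSpace he (lie_mem_restrictedRootSpace he hz)))
      intro h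
      exact hε (eq_neg_of_add_eq_zero_right (left_eq_add.mp h.symm))
    exact hle hz
  have hT' : ∀ z ∈ restrictedRootSpace 𝔞 (-γ), ⁅e, ⁅e, z⁆⁆ ∈ restrictedRootSpace 𝔞 γ := by
    intro z hz
    simpa using lie_mem_restrictedRootSpace he (lie_mem_restrictedRootSpace he hz)
  have hdisj := Submodule.disjoint_def.mp (iSupIndep_restrictedRootSpace h𝔞 γ)
  obtain ⟨z, hz⟩ : e ∈ LinearMap.range (ad ℝ 𝔤 e ∘ₗ ad ℝ 𝔤 e) := by
    by_contra hne
    obtain ⟨f, hf, hrange⟩ := Submodule.exists_le_ker_of_notMem hne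
    obtain ⟨x, rfl⟩ := ((killingForm ℝ 𝔤).toDual
      (IsKilling.killingForm_nondegenerate ℝ 𝔤)).surjective f
    have hadj : ∀ u v : 𝔤, killingForm ℝ 𝔤 ⁅e, ⁅e, u⁆⁆ v = killingForm ℝ 𝔤 u ⁅e, ⁅e, v⁆⁆ := by
      intro u v
      have h1 := LieModule.traceForm_apply_lie_apply' ℝ 𝔤 𝔤 e ⁅e, u⁆ v
      have h2 := LieModule.traceForm_apply_lie_apply' ℝ 𝔤 𝔤 e u ⁅e, v⁆
      exact h1.trans ((congrArg Neg.neg h2).trans (neg_neg _))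
    have hx : ⁅e, ⁅e, x⁆⁆ = 0 := by
      have : ⁅e, ⁅e, x⁆⁆ ∈ LinearMap.ker (killingForm ℝ 𝔤) := by
        refine LinearMap.ext fun v => ?_
        rw [hadj]
        exact hrange ⟨v, rfl⟩
      simpa [IsKilling.ker_killingForm_eq_bot] using this
    obtain ⟨x₀, hx₀, r, hr, rfl⟩ := exists_add_of_mem_restrictedRootSpace h𝔞 (-γ) x
    have hx₀' : ⁅e, ⁅e, x₀⁆⁆ = 0 := by
      refine hdisj _ (hT' _ hx₀) ?_
      rw [lie_add, lie_add] at hx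
      rw [eq_neg_of_add_eq_zero_left hx]
      exact neg_mem (hT _ hr)
    apply hf
    change killingForm ℝ 𝔤 (x₀ + r) e = 0
    rw [LieModule.traceForm_comm, map_add, killingForm_eq_zero_of_mem_iSup he hr,
      killingForm_eq_zero_of_lie_lie_eq_zero hγ he hx₀ hx₀', add_zero]
  obtain ⟨z₀, hz₀, r, hr, rfl⟩ := exists_add_of_mem_restrictedRootSpace h𝔞 (-γ) z
  refine ⟨z₀, hz₀, ?_⟩
  have hz' : ⁅e, ⁅e, z₀⁆⁆ + ⁅e, ⁅e, r⁆⁆ = e := by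
    rw [← lie_add, ← lie_add]
    exact hz
  refine sub_eq_zero.mp (hdisj _ (sub_mem (hT' _ hz₀) he) ?_)
  have : ⁅e, ⁅e, z₀⁆⁆ - e = -⁅e, ⁅e, r⁆⁆ := by
    rw [sub_eq_iff_eq_add, ← sub_eq_iff_eq_add'.mpr hz'.symm]
    abel
  rw [this]
  exact neg_mem (hT _ hr)

/-- If `ad h` is triangularizable, then its semisimple part is the adjoint action of some `s`. -/
theorem exists_ad_semisimple_part {h : 𝔤} (hh : ⨆ μ, (ad ℝ 𝔤 h).maxGenEigenspace μ = ⊤) :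
    ∃ s : 𝔤, Commute (ad ℝ 𝔤 h) (ad ℝ 𝔤 s) ∧ IsNilpotent (ad ℝ 𝔤 h - ad ℝ 𝔤 s) ∧
      ∀ μ, ∀ x ∈ (ad ℝ 𝔤 h).maxGenEigenspace μ, ⁅s, x⁆ = μ • x := by
  obtain ⟨n, -, S, hS, hn, hss, hsum⟩ := exists_isNilpotent_isSemisimple (f := ad ℝ 𝔤 h)
  have hcomm : Commute (ad ℝ 𝔤 h) S := Algebra.commute_of_mem_adjoin_self hS
  have hnil : IsNilpotent (ad ℝ 𝔤 h - S) := by rwa [hsum, add_sub_cancel_right]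
  have hSx : ∀ μ, ∀ x ∈ (ad ℝ 𝔤 h).maxGenEigenspace μ, S x = μ • x := fun μ x hx =>
    apply_eq_of_mem_of_comm_of_isFinitelySemisimple_of_isNil hx hcomm
      hss.isFinitelySemisimple hnil
  have hleib : ∀ x y : 𝔤, S ⁅x, y⁆ = ⁅x, S y⁆ - ⁅y, S x⁆ := by
    intro x y
    have hx : x ∈ ⨆ μ, (ad ℝ 𝔤 h).maxGenEigenspace μ := hh ▸ Submodule.mem_top
    have hy : y ∈ ⨆ μ, (ad ℝ 𝔤 h).maxGenEigenspace μ := hh ▸ Submodule.mem_top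
    induction hx using Submodule.iSup_induction' with
    | zero => simp
    | add x x' _ _ ihx ihx' =>
      rw [add_lie, map_add, ihx, ihx', map_add, add_lie, lie_add]
      abel
    | mem μ x hx =>
      induction hy using Submodule.iSup_induction' with
      | zero => simp
      | add y y' _ _ ihy ihy' =>
        rw [lie_add, map_add, ihy, ihy', map_add, add_lie, lie_add]
        abel
      | mem ν y hy =>
        rw [hSx μ x hx, hSx ν y hy, hSx (μ + ν) ⁅x, y⁆
          (LieModule.lie_mem_maxGenEigenspace_toEnd hx hy), lie_smul, lie_smul, ← lie_skew x y,
          add_smul]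
        simp only [smul_neg]
        abel
  obtain ⟨s, hs⟩ := LieDerivation.IsKilling.exists_eq_ad (R := ℝ) (L := 𝔤) ⟨S, hleib⟩
  have hsS : ad ℝ 𝔤 s = S := by
    rw [← LieDerivation.coe_ad_apply_eq_ad_apply, hs]
  refine ⟨s, hsS ▸ hcomm, hsS ▸ hnil, fun μ x hx => ?_⟩
  rw [← hSx μ x hx, ← hsS, ad_apply]

theorem exists_lie_eq_and_le_maxGenEigenspace (h𝔞 : IsMaximalRDiagonalizable 𝔞) (hγ : γ ≠ 0)
    {e : 𝔤} (he : e ∈ restrictedRootSpace 𝔞 γ) (he0 : e ≠ 0) :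
    ∃ z ∈ restrictedRootSpace 𝔞 (-γ), ⁅⁅e, z⁆, e⁆ = (2 : ℕ) • e ∧ ∃ s : 𝔞, γ s = 2 ∧
      ∀ δ, restrictedRootSpace 𝔞 δ ≤ (ad ℝ 𝔤 ⁅e, z⁆).maxGenEigenspace (δ s) := by
  obtain ⟨z₀, hz₀, hez₀⟩ := exists_lie_lie_eq h𝔞 hγ he
  obtain ⟨z, hz⟩ : ∃ z, z = (-2 : ℝ) • z₀ := ⟨_, rfl⟩
  have hzγ : z ∈ restrictedRootSpace 𝔞 (-γ) := hz ▸ Submodule.smul_mem _ _ hz₀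
  have hhe : ⁅⁅e, z⁆, e⁆ = (2 : ℕ) • e := by
    rw [← lie_skew, hz, lie_smul, lie_smul, hez₀, ← Nat.cast_smul_eq_nsmul ℝ]
    simp
  have hH := (ad_lie_eq_sub e z).symm
  have hE : ad ℝ 𝔤 ⁅e, z⁆ * ad ℝ 𝔤 e - ad ℝ 𝔤 e * ad ℝ 𝔤 ⁅e, z⁆ = 2 • ad ℝ 𝔤 e := by
    rw [← ad_lie_eq_sub, hhe, map_nsmul]
  have htop := iSup_maxGenEigenspace_eq_top_of_sl2 hH hE
    (isNilpotent_ad_of_mem_restrictedRootSpace hγ he)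
  have h0 : ⁅e, z⁆ ∈ restrictedRootSpace 𝔞 0 := by
    simpa using lie_mem_restrictedRootSpace he hzγ
  obtain ⟨s, hcomm, hnil, hs⟩ := exists_ad_semisimple_part htop
  have hdiag : ⨆ μ, (ad ℝ 𝔤 s).eigenspace μ = ⊤ := by
    rw [eq_top_iff, ← htop]
    exact iSup_mono fun μ x hx => mem_eigenspace_iff.mpr (hs μ x hx)
  have heig : ∀ μ x, ⁅⁅e, z⁆, x⁆ = μ • x → ⁅s, x⁆ = μ • x := fun μ x hx =>
    hs μ x ((genEigenspace _ μ).monotone le_top (mem_eigenspace_iff.mpr hx))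
  have hsa : ∀ a : 𝔞, ⁅(a : 𝔤), s⁆ = 0 := by
    intro a
    have h1 : ⁅⁅e, z⁆, (a : 𝔤)⁆ = (0 : ℝ) • (a : 𝔤) := by
      rw [← lie_skew, h0 a]
      simp
    rw [← lie_skew, heig 0 a h1, zero_smul, neg_zero]
  have hs𝔞 := mem_of_iSup_eigenspace_eq_top_of_lie_eq_zero h𝔞 hdiag hsa
  refine ⟨z, hzγ, hhe, ⟨s, hs𝔞⟩, ?_, fun δ x hx =>
    mem_maxGenEigenspace_of_sub_isNilpotent hcomm hnil (hx ⟨s, hs𝔞⟩)⟩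
  refine smul_left_injective ℝ he0 ?_
  change γ ⟨s, hs𝔞⟩ • e = (2 : ℝ) • e
  rw [← he ⟨s, hs𝔞⟩]
  exact heig 2 e (by rw [hhe, ← Nat.cast_smul_eq_nsmul ℝ]; simp)

theorem finrank_restrictedRootSpace_le (h𝔞 : IsMaximalRDiagonalizable 𝔞)
    (δ : Module.Dual ℝ 𝔞) :
    Module.finrank ℝ (restrictedRootSpace 𝔞 δ) ≤ Module.finrank ℝ (restrictedRootSpace 𝔞 (-δ)) := by
  rw [← Subspace.dual_finrank_eq (V := restrictedRootSpace 𝔞 (-δ))]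
  refine LinearMap.finrank_le_finrank_of_injective
    (f := (killingForm ℝ 𝔤).domRestrict₁₂ (restrictedRootSpace 𝔞 δ)
      (restrictedRootSpace 𝔞 (-δ))) ?_
  refine (injective_iff_map_eq_zero _).mpr fun x hx => Subtype.ext ?_
  exact eq_zero_of_forall_killingForm_eq_zero h𝔞 x.2
    fun y hy => LinearMap.congr_fun hx ⟨y, hy⟩

theorem finrank_restrictedRootSpace_neg (h𝔞 : IsMaximalRDiagonalizable 𝔞)
    (δ : Module.Dual ℝ 𝔞) :
    Module.finrank ℝ (restrictedRootSpace 𝔞 (-δ)) = Module.finrank ℝ (restrictedRootSpace 𝔞 δ) := by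
  refine le_antisymm ?_ (finrank_restrictedRootSpace_le h𝔞 δ)
  have h : - -δ = δ := neg_neg δ
  exact (finrank_restrictedRootSpace_le h𝔞 (-δ)).trans_eq (by rw [h])

theorem exists_ad_pow_eq (h𝔞 : IsMaximalRDiagonalizable 𝔞) {e z : 𝔤} {s : 𝔞} (hγ : γ ≠ 0)
    (he : e ∈ restrictedRootSpace 𝔞 γ) (hhe : ⁅⁅e, z⁆, e⁆ = (2 : ℕ) • e) (hγs : γ s = 2)
    (hs : ∀ δ, restrictedRootSpace 𝔞 δ ≤ (ad ℝ 𝔤 ⁅e, z⁆).maxGenEigenspace (δ s))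
    {m : ℕ} (hδ : m • γ + -δ = δ) (hx : x ∈ restrictedRootSpace 𝔞 δ) :
    ∃ y ∈ restrictedRootSpace 𝔞 (-δ), ((ad ℝ 𝔤 e) ^ m) y = x := by
  have hδs : δ s = m := by
    have h := LinearMap.congr_fun hδ s
    simp only [LinearMap.add_apply, LinearMap.smul_apply, LinearMap.neg_apply, hγs,
      nsmul_eq_mul] at h
    linarith
  let φ : restrictedRootSpace 𝔞 (-δ) →ₗ[ℝ] restrictedRootSpace 𝔞 δ :=
    ((ad ℝ 𝔤 e) ^ m).restrict fun y hy => hδ ▸ ad_pow_mem_restrictedRootSpace he hy m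
  have hφ : Function.Injective φ := by
    refine (injective_iff_map_eq_zero _).mpr fun y hy => ?_
    by_contra hy0
    have hym : ((ad ℝ 𝔤 e) ^ m) (y : 𝔤) = 0 := congrArg Subtype.val hy
    obtain ⟨k, i, hki, hk, heq⟩ := exists_nat_two_mul_add_apply_eq hγ he hhe hγs hs y.2
      (fun h => hy0 (Subtype.ext h))
    have hkm : k < m := by
      by_contra! hmk
      apply hk
      rw [← Nat.sub_add_cancel hmk, pow_add, Module.End.mul_apply, hym, map_zero]
    rw [LinearMap.neg_apply, hδs] at heq
    have h1 : (k : ℝ) ≤ i := by exact_mod_cast hki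
    have h2 : (k : ℝ) < m := by exact_mod_cast hkm
    linarith
  obtain ⟨y, hy⟩ := (LinearMap.injective_iff_surjective_of_finrank_eq_finrank
    (finrank_restrictedRootSpace_neg h𝔞 δ)).mp hφ ⟨x, hx⟩
  exact ⟨y, y.2, congrArg Subtype.val hy⟩

end RestrictedRoots

/-- **Lemma.**  Let `𝔤` be a finite-dimensional real semisimple Lie algebra, `𝔞` a maximal
`ℝ`-diagonalizable subalgebra, and `β ∈ Σ`.  If a Lie subalgebra `𝔥 ⊆ 𝔤` contains
`𝔤_{[-β]}` and contains some nonzero `Y ∈ 𝔤_{[β]}`, then `𝔤_{[β]} ⊆ 𝔥`. -/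
theorem coarseRootSpace_le_of_mem
    [FiniteDimensional ℝ 𝔤] [LieAlgebra.IsSemisimple ℝ 𝔤]
    (𝔞 : LieSubalgebra ℝ 𝔤) (h𝔞 : IsMaximalRDiagonalizable 𝔞)
    (β : Module.Dual ℝ ↥𝔞) (hβ : β ∈ restrictedRoots 𝔞)
    (𝔥 : LieSubalgebra ℝ 𝔤)
    (hneg : ∀ x ∈ coarseRootSpace 𝔞 (-β), x ∈ 𝔥)
    (Y : 𝔤) (hY : Y ∈ coarseRootSpace 𝔞 β) (hY0 : Y ≠ 0) (hYmem : Y ∈ 𝔥) :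
    ∀ x ∈ coarseRootSpace 𝔞 β, x ∈ 𝔥 := by
  have hneg' : ∀ t : ℝ, 0 < t → ∀ x ∈ restrictedRootSpace 𝔞 (-(t • β)), x ∈ 𝔥 := by
    intro t ht x hx
    have h : -(t • β) = t • -β := (smul_neg t β).symm
    rw [h] at hx
    exact hneg x (restrictedRootSpace_smul_le_coarseRootSpace (neg_ne_zero.mpr hβ.1) ht hx)
  obtain ⟨f, hfβ, hfpos, rfl⟩ := exists_finsupp_of_mem_coarseRootSpace hY
  have hne : f.support.Nonempty := by
    by_contra h
    exact hY0 (by rw [Finset.not_nonempty_iff_eq_empty.mp h, Finset.sum_empty])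
  obtain ⟨T, hT, hmax⟩ := f.support.exists_max_image id hne
  have hT0 := hfpos T hT
  have hγ : T • β ≠ 0 := smul_ne_zero hT0.ne' hβ.1
  obtain ⟨z, hz, hhe, s, hγs, hs⟩ := exists_lie_eq_and_le_maxGenEigenspace h𝔞 hγ (hfβ T)
    (Finsupp.mem_support_iff.mp hT)
  have hzmem := hneg' T hT0 z hz
  have hlie : ∀ t ∈ f.support.erase T, ⁅f t, z⁆ ∈ 𝔥 := by
    intro t ht
    obtain ⟨htT, ht⟩ := Finset.mem_erase.mp ht
    refine hneg' (T - t) (sub_pos.mpr (lt_of_le_of_ne (hmax t ht) htT)) _ ?_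
    have h : -((T - t) • β) = t • β + -(T • β) := by module
    rw [h]
    exact lie_mem_restrictedRootSpace (hfβ t) hz
  have hh : ⁅f T, z⁆ ∈ 𝔥 := by
    have h := 𝔥.lie_mem hYmem hzmem
    rw [← Finset.add_sum_erase _ _ hT, add_lie, sum_lie] at h
    exact (𝔥.toSubmodule.add_mem_iff_left (sum_mem hlie)).mp h
  have hβs : T * β s = 2 := hγs
  have he : f T ∈ 𝔥 := by
    refine mem_of_sum_mem_of_maxGenEigenspace (H := LieAlgebra.ad ℝ 𝔤 ⁅f T, z⁆)
      (W := 𝔥.toSubmodule) (fun x hx => 𝔥.lie_mem hh hx) f.support (fun t => (t • β) s) f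
      (fun t _ => hs _ (hfβ t)) hYmem hT fun t _ htT h => htT ?_
    have hβs0 : β s ≠ 0 := fun h => by simp [h] at hβs
    exact mul_right_cancel₀ hβs0 h
  have hpow : ∀ m : ℕ, ∀ y ∈ 𝔥, ((LieAlgebra.ad ℝ 𝔤 (f T)) ^ m) y ∈ 𝔥 := by
    intro m y hy
    induction m with
    | zero => exact hy
    | succ m ih =>
      rw [pow_succ', Module.End.mul_apply]
      exact 𝔥.lie_mem he ih
  suffices coarseRootSpace 𝔞 β ≤ 𝔥.toSubmodule from this
  refine iSup₂_le fun t ht x hx => ?_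
  by_cases hx0 : x = 0
  · exact hx0 ▸ zero_mem 𝔥
  obtain ⟨k, i, -, -, hki⟩ := exists_nat_two_mul_add_apply_eq hγ (hfβ T) hhe hγs hs hx hx0
  have hts : T * (t * β s) = t * 2 := by rw [← hβs]; ring
  have hki' : 2 * (k : ℝ) + t * β s = i := hki
  have hβs0 : 0 < β s := pos_of_mul_pos_right (hβs ▸ two_pos) hT0.le
  have hlt : 2 * k < i := by
    have : (2 * k : ℝ) < i := by linarith [mul_pos ht.1 hβs0]
    exact_mod_cast this
  obtain ⟨m, rfl⟩ := Nat.exists_eq_add_of_lt hlt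
  obtain ⟨y, hy, rfl⟩ := exists_ad_pow_eq h𝔞 (m := m + 1) hγ (hfβ T) hhe hγs hs (by
    rw [← Nat.cast_smul_eq_nsmul ℝ, smul_smul, ← sub_eq_add_neg, ← sub_smul]
    congr 1
    push_cast at hki' ⊢
    have : t * β s = m + 1 := by linarith
    rw [this] at hts
    linarith) hx
  exact hpow _ _ (hneg' t ht.1 y hy)
end

section
/- Let β ∈ Σ, let 𝔟₂ = ⨁_{γ ∈ Σ, γ ∉ ℝβ} 𝔤_γ, and let 𝔰 be a simple ideal of 𝔤 of real rank at least 2, i.e. dim_ℝ(𝔞 ∩ 𝔰) ≥ 2. Then 𝔰 is contained in the Lie subalgebra ⟨𝔟₂⟩ of 𝔤 generated by 𝔟₂. -/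
variable {𝔤 : Type*} [LieRing 𝔤] [LieAlgebra ℝ 𝔤]

/-- `𝔟₂ = ⨁_{γ ∈ Σ, γ ∉ ℝβ} 𝔤_γ`: the sum of the restricted root spaces for the roots that
are not real multiples of `β`. -/
def rootSpacesOffLine (𝔞 : LieSubalgebra ℝ 𝔤) (β : Module.Dual ℝ ↥𝔞) : Submodule ℝ 𝔤 :=
  ⨆ γ : Module.Dual ℝ ↥𝔞,
    ⨆ _ : γ ∈ restrictedRoots 𝔞 ∧ ∀ t : ℝ, γ ≠ t • β, restrictedRootSpace 𝔞 γ

/-- If the eigenspaces of `f` span, then every generalized eigenspace is an eigenspace. -/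
lemma Module.End.maxGenEigenspace_eq_eigenspace_of_iSup_eigenspace_eq_top
    {K M : Type*} [Field K] [AddCommGroup M] [Module K M] (f : Module.End K M)
    (h : ⨆ μ, f.eigenspace μ = ⊤) (μ : K) :
    f.maxGenEigenspace μ = f.eigenspace μ :=
  congrFun ((f.independent_maxGenEigenspace.le_iff_eq_of_iSup_eq_top h).mp
    fun ν ↦ (f.genEigenspace ν).monotone le_top).symm μ

lemma lie_mem_restrictedRootSpace_add {𝔞 : LieSubalgebra ℝ 𝔤} {γ δ : Module.Dual ℝ ↥𝔞}
    {x y : 𝔤} (hx : x ∈ restrictedRootSpace 𝔞 γ) (hy : y ∈ restrictedRootSpace 𝔞 δ) :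
    ⁅x, y⁆ ∈ restrictedRootSpace 𝔞 (γ + δ) := fun a ↦ by
  rw [leibniz_lie, hx a, hy a, smul_lie, lie_smul, LinearMap.add_apply, add_smul]

/-- The restricted root space decomposition: the simultaneous eigenspaces of `𝔞` span `𝔤`. -/
lemma iSup_restrictedRootSpace_eq_top_s5 [FiniteDimensional ℝ 𝔤] {𝔞 : LieSubalgebra ℝ 𝔤}
    (hab : IsLieAbelian ↥𝔞)
    (hdiag : ∀ a ∈ 𝔞, ⨆ μ : ℝ, Module.End.eigenspace (LieAlgebra.ad ℝ 𝔤 a) μ = ⊤) :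
    ⨆ γ, restrictedRootSpace 𝔞 γ = ⊤ := by
  have hgen (a : 𝔞) := (LieAlgebra.ad ℝ 𝔤 a)
    |>.maxGenEigenspace_eq_eigenspace_of_iSup_eigenspace_eq_top (hdiag a a.2)
  have hcomm : Pairwise fun a b : 𝔞 ↦
      Commute (LieAlgebra.ad ℝ 𝔤 (a : 𝔤)) (LieAlgebra.ad ℝ 𝔤 (b : 𝔤)) := fun a b _ ↦ by
    have h0 : ⁅(a : 𝔤), (b : 𝔤)⁆ = 0 := congrArg Subtype.val (hab.trivial a b)
    refine LinearMap.ext fun x ↦ ?_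
    change ⁅(a : 𝔤), ⁅(b : 𝔤), x⁆⁆ = ⁅(b : 𝔤), ⁅(a : 𝔤), x⁆⁆
    rw [leibniz_lie, h0, zero_lie, zero_add]
  have htop :=
    Module.End.iSup_iInf_maxGenEigenspace_eq_top_of_iSup_maxGenEigenspace_eq_top_of_commute
      (fun a : 𝔞 ↦ LieAlgebra.ad ℝ 𝔤 (a : 𝔤)) hcomm
      (fun a ↦ by simpa only [hgen] using hdiag a a.2)
  rw [eq_top_iff, ← htop]
  refine iSup_le fun χ x hx ↦ ?_
  have hχ (a : 𝔞) : ⁅(a : 𝔤), x⁆ = χ a • x := by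
    have := (Submodule.mem_iInf _).mp hx a
    rwa [hgen, Module.End.mem_eigenspace_iff] at this
  rcases eq_or_ne x 0 with rfl | hx0
  · exact zero_mem _
  let γ : Module.Dual ℝ 𝔞 :=
    { toFun := χ
      map_add' := fun a b ↦ smul_left_injective ℝ hx0 <| by
        simp only [add_smul, ← hχ, AddMemClass.coe_add, add_lie]
      map_smul' := fun c a ↦ smul_left_injective ℝ hx0 <| by
        simp only [smul_assoc, ← hχ, SetLike.val_smul, smul_lie, RingHom.id_apply] }
  exact le_iSup (restrictedRootSpace 𝔞) γ hχ

lemma restrictedRootSpace_le_rootSpacesOffLine {𝔞 : LieSubalgebra ℝ 𝔤}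
    {β γ : Module.Dual ℝ ↥𝔞} (h : ∀ t : ℝ, γ ≠ t • β) :
    restrictedRootSpace 𝔞 γ ≤ rootSpacesOffLine 𝔞 β := by
  by_cases hγ : restrictedRootSpace 𝔞 γ = ⊥
  · exact hγ ▸ bot_le
  · exact le_iSup₂_of_le γ ⟨⟨fun h0 ↦ h 0 (by simpa using h0), hγ⟩, h⟩ le_rfl

/-- Root spaces on the line `ℝβ` normalize the sum of the root spaces off that line. -/
lemma lie_mem_rootSpacesOffLine {𝔞 : LieSubalgebra ℝ 𝔤} {β : Module.Dual ℝ ↥𝔞} {t : ℝ}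
    {x y : 𝔤} (hx : x ∈ restrictedRootSpace 𝔞 (t • β)) (hy : y ∈ rootSpacesOffLine 𝔞 β) :
    ⁅x, y⁆ ∈ rootSpacesOffLine 𝔞 β := by
  suffices rootSpacesOffLine 𝔞 β ≤
      (rootSpacesOffLine 𝔞 β).comap (LieAlgebra.ad ℝ 𝔤 x : 𝔤 →ₗ[ℝ] 𝔤) from this hy
  refine iSup₂_le fun δ hδ z hz ↦ restrictedRootSpace_le_rootSpacesOffLine (fun s hs ↦ ?_)
    (lie_mem_restrictedRootSpace_add hx hz)
  refine hδ.2 (s - t) (LinearMap.ext fun a ↦ ?_)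
  have := LinearMap.congr_fun hs a
  simp only [LinearMap.add_apply, LinearMap.smul_apply, smul_eq_mul] at this ⊢
  linarith

/-- The root spaces off a line generate an ideal. -/
lemma lie_mem_lieSpan_rootSpacesOffLine {𝔞 : LieSubalgebra ℝ 𝔤}
    (htop : ⨆ γ, restrictedRootSpace 𝔞 γ = ⊤) (β : Module.Dual ℝ ↥𝔞) (x : 𝔤) {y : 𝔤}
    (hy : y ∈ LieSubalgebra.lieSpan ℝ 𝔤 (rootSpacesOffLine 𝔞 β : Set 𝔤)) :
    ⁅x, y⁆ ∈ LieSubalgebra.lieSpan ℝ 𝔤 (rootSpacesOffLine 𝔞 β : Set 𝔤) := by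
  have hx : x ∈ ⨆ γ, restrictedRootSpace 𝔞 γ := htop ▸ Submodule.mem_top
  induction hx using Submodule.iSup_induction' with
  | zero => simp
  | add x₁ x₂ _ _ h₁ h₂ => rw [add_lie]; exact add_mem h₁ h₂
  | mem γ x hx =>
    by_cases hγ : ∀ t : ℝ, γ ≠ t • β
    · exact LieSubalgebra.lie_mem _
        (LieSubalgebra.subset_lieSpan (restrictedRootSpace_le_rootSpacesOffLine hγ hx)) hy
    · push Not at hγ
      obtain ⟨t, rfl⟩ := hγ
      induction hy using LieSubalgebra.lieSpan_induction with
      | mem z hz => exact LieSubalgebra.subset_lieSpan (lie_mem_rootSpacesOffLine hx hz)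
      | zero => simp
      | add z w _ _ hz hw => rw [lie_add]; exact add_mem hz hw
      | smul c z _ hz => rw [lie_smul]; exact LieSubalgebra.smul_mem _ c hz
      | lie z w hz hw hz' hw' =>
        rw [leibniz_lie]
        exact add_mem (LieSubalgebra.lie_mem _ hz' hw) (LieSubalgebra.lie_mem _ hz hw')

/-- The kernel of `β` maps `𝔤` into the sum of the root spaces off the line `ℝβ`. -/
lemma lie_mem_rootSpacesOffLine_of_apply_eq_zero {𝔞 : LieSubalgebra ℝ 𝔤}
    (htop : ⨆ γ, restrictedRootSpace 𝔞 γ = ⊤) {β : Module.Dual ℝ ↥𝔞} {a : 𝔞} (ha : β a = 0)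
    (x : 𝔤) : ⁅(a : 𝔤), x⁆ ∈ rootSpacesOffLine 𝔞 β := by
  have hx : x ∈ ⨆ γ, restrictedRootSpace 𝔞 γ := htop ▸ Submodule.mem_top
  induction hx using Submodule.iSup_induction' with
  | zero => simp
  | add x₁ x₂ _ _ h₁ h₂ => rw [lie_add]; exact add_mem h₁ h₂
  | mem γ x hx =>
    rw [hx a]
    by_cases hγ : γ a = 0
    · simp [hγ]
    · refine Submodule.smul_mem _ _ (restrictedRootSpace_le_rootSpacesOffLine (fun t ht ↦ hγ ?_) hx)
      simp [ht, ha]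

lemma exists_mem_ne_zero_apply_eq_zero {𝔞 : LieSubalgebra ℝ 𝔤} (β : Module.Dual ℝ ↥𝔞)
    (V : Submodule ℝ 𝔤) (hV : 2 ≤ Module.finrank ℝ ↥(𝔞.toSubmodule ⊓ V)) :
    ∃ a : 𝔞, (a : 𝔤) ∈ V ∧ a ≠ 0 ∧ β a = 0 := by
  have : FiniteDimensional ℝ ↥(𝔞.toSubmodule ⊓ V) :=
    FiniteDimensional.of_finrank_pos (by lia)
  let f : ↥(𝔞.toSubmodule ⊓ V) →ₗ[ℝ] ℝ := β ∘ₗ Submodule.inclusion inf_le_left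
  have hker : f.ker ≠ ⊥ := LinearMap.ker_ne_bot_of_finrank_lt (by rw [Module.finrank_self]; lia)
  obtain ⟨v, hv, hv0⟩ := Submodule.exists_mem_ne_zero_of_ne_bot hker
  exact ⟨⟨v, v.2.1⟩, v.2.2, fun h ↦ hv0 (Subtype.ext (congrArg (Subtype.val : 𝔞 → 𝔤) h)), hv⟩

/-- **Lemma.**  Let `𝔤` be a finite-dimensional real semisimple Lie algebra, `𝔞` a maximal
`ℝ`-diagonalizable subalgebra, `β ∈ Σ`, and `𝔟₂ = ⨁_{γ ∈ Σ, γ ∉ ℝβ} 𝔤_γ`.  If `𝔰` is a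
simple ideal of `𝔤` of real rank at least `2`, i.e. `dim_ℝ (𝔞 ∩ 𝔰) ≥ 2`, then `𝔰` is
contained in the Lie subalgebra `⟨𝔟₂⟩` generated by `𝔟₂`. -/
theorem simple_ideal_le_lieSpan_rootSpacesOffLine
    [FiniteDimensional ℝ 𝔤] [LieAlgebra.IsSemisimple ℝ 𝔤]
    (𝔞 : LieSubalgebra ℝ 𝔤) (h𝔞 : IsMaximalRDiagonalizable 𝔞)
    (β : Module.Dual ℝ ↥𝔞) (hβ : β ∈ restrictedRoots 𝔞)
    (𝔰 : LieIdeal ℝ 𝔤) (hsimple : LieAlgebra.IsSimple ℝ ↥𝔰)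
    (hrank : 2 ≤ Module.finrank ℝ ↥(𝔞.toSubmodule ⊓ (𝔰 : Submodule ℝ 𝔤))) :
    ∀ x ∈ 𝔰, x ∈ LieSubalgebra.lieSpan ℝ 𝔤 (rootSpacesOffLine 𝔞 β : Set 𝔤) := by
  have htop := iSup_restrictedRootSpace_eq_top_s5 h𝔞.1 h𝔞.2.1
  obtain ⟨a, ha𝔰, ha0, haβ⟩ := exists_mem_ne_zero_apply_eq_zero β _ hrank
  let J : LieIdeal ℝ 𝔤 :=
    { (LieSubalgebra.lieSpan ℝ 𝔤 (rootSpacesOffLine 𝔞 β : Set 𝔤)).toSubmodule with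
      lie_mem := fun {x _} hy ↦ lie_mem_lieSpan_rootSpacesOffLine htop β x hy }
  rcases hsimple.eq_bot_or_eq_top (J.comap 𝔰.incl) with hJ | hJ
  · refine absurd (Subtype.ext ?_) ha0
    have hcenter : (a : 𝔤) ∈ LieAlgebra.center ℝ 𝔤 := by
      refine (LieModule.mem_maxTrivSubmodule ℝ 𝔤 𝔤 _).mpr fun x ↦ ?_
      have hmem : (⟨⁅(a : 𝔤), x⁆, lie_mem_left ℝ 𝔤 𝔰 _ x ha𝔰⟩ : 𝔰) ∈ J.comap 𝔰.incl :=
        LieSubalgebra.subset_lieSpan (lie_mem_rootSpacesOffLine_of_apply_eq_zero htop haβ x)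
      rw [hJ, LieSubmodule.mem_bot] at hmem
      rw [← lie_skew, neg_eq_zero]
      exact congrArg Subtype.val hmem
    rwa [LieAlgebra.center_eq_bot, LieSubmodule.mem_bot] at hcenter
  · intro x hx
    have hmem : (⟨x, hx⟩ : 𝔰) ∈ J.comap 𝔰.incl := hJ ▸ LieSubmodule.mem_top _
    exact hmem
end
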